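/- arXiv:1912.11758 — 2 statements merged into one kernel-verified Lean document; each statement's English description precedes it below -/
import Mathlib

section
/- There exists a binary self-dual code C ⊆ (ZMod 2)^{68} of dimension 34 whose minimum nonzero Hamming weight is 12, such that the number of codewords of Hamming weight 12 is 1202 and the number of codewords of Hamming weight 14 is 12416 (i.e. C is an extremal self-dual [68,34,12] code with weight enumerator W_{68,2} for γ = 4, β = 190). -/
/-- The dual of a linear code `C ⊆ Rⁿ` with respect to the form `∑ᵢ vᵢ wᵢ`. -/
def dualCode {R : Type*} [CommRing R] {ι : Type*} [Fintype ι]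
    (C : Submodule R (ι → R)) : Submodule R (ι → R) where
  carrier := {w | ∀ v ∈ C, ∑ i, v i * w i = 0}
  zero_mem' := by intro v _; simp
  add_mem' := by
    intro a b ha hb v hv
    have h1 := ha v hv
    have h2 := hb v hv
    simp only [Pi.add_apply, mul_add, Finset.sum_add_distrib, h1, h2, add_zero]
  smul_mem' := by
    intro c w hw v hv
    have h := hw v hv
    have : ∑ i, v i * (c • w) i = c * ∑ i, v i * w i := by
      rw [Finset.mul_sum]
      exact Finset.sum_congr rfl fun i _ => by
        simp [smul_eq_mul, mul_left_comm]
    simp only [Set.mem_setOf_eq] at *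
    simpa [h] using this

open scoped Nat

/-- The XORs of the values of `b` along all `k`-element sublists of a list, packed into one number
in the order of `List.sublistsLen`. Binomial coefficients are written through `Nat.descFactorial`
and `Nat.factorial`, which evaluate fast in the kernel. -/
def combinationSlice {ι : Type*} (b : ι → Bool) : List ι → ℕ → ℕ
  | [], _ => 0
  | _ :: _, 0 => 0
  | i :: l, k + 1 =>
    combinationSlice b l (k + 1) |||
      ((combinationSlice b l k ^^^ bif b i then 2 ^ (l.length.descFactorial k / k !) - 1 else 0) <<<
        (l.length.descFactorial (k + 1) / (k + 1)!))

/-- Add a slice of bits to bit-sliced counters, whose digit slices are listed lowest first. -/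
def addSlice : List ℕ → ℕ → List ℕ
  | [], s => bif s == 0 then [] else [s]
  | c :: cs, s => (c ^^^ s) :: addSlice cs (c &&& s)

/-- The positions at which bit-sliced counters hold the value `o`. -/
def eqMask (full : ℕ) : List ℕ → ℕ → ℕ
  | [], o => bif o == 0 then full else 0
  | c :: cs, o => (bif o % 2 == 0 then c ^^^ full else c) &&& eqMask full cs (o / 2)

/-- The number of ones of `x`, at most `d`, found by repeatedly clearing the lowest one. -/
def clearCount : ℕ → ℕ → ℕ
  | 0, _ => 0
  | d + 1, x => bif x == 0 then 0 else clearCount d (x &&& (x - 1)) + 1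

/-- The number of ones of `x < 2 ^ 2 ^ (d + 12)`, found by repeated halving. -/
def popCount : ℕ → ℕ → ℕ
  | 0, x => clearCount (2 ^ 12) x
  | d + 1, x => bif x == 0 then 0 else
      popCount d (x >>> 2 ^ (d + 12)) + popCount d (x ^^^ ((x >>> 2 ^ (d + 12)) <<< 2 ^ (d + 12)))

/-- The number of sums of `k` distinct rows of `B` (over `ZMod 2`) that have weight `o`. -/
def combinationCount {n : ℕ} (B : Fin n → Fin n → Bool) (k o : ℕ) : ℕ :=
  popCount (Nat.log2 (n.descFactorial k / k !) - 11)
    (eqMask (2 ^ (n.descFactorial k / k !) - 1)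
      (((List.finRange n).map fun j => combinationSlice (B · j) (List.finRange n) k).foldl
        addSlice []) o)

/-- The number of words of weight `w` in the code generated by `(1 | B)`, for `B` orthogonal: words
whose left half is the heavier one are counted by their right half. -/
def weightCount {n : ℕ} (B : Fin n → Fin n → Bool) (w : ℕ) : ℕ :=
  ((List.range (w / 2 + 1)).map fun k => combinationCount B k (w - k)).sum +
    ((List.range (w - w / 2)).map fun k => combinationCount (fun i j => B j i) k (w - k)).sum

/-- The rows of the right half of a systematic generator matrix, as binary numbers. -/
def generatorRows : List ℕ :=
  [8109112911, 12404303593, 4837408074, 12327062316, 12200092919, 2858629521, 12171235826,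
    1432265300, 5804338359, 16718135569, 623653138, 7080456820, 11799028847, 5628475913,
    13227549386, 650875500, 6765809607, 11256436481, 11688856578, 6300187140, 13914173127,
    7068337096, 11125032296, 13125486248, 8353803872, 12664647264, 2403806816, 1334373984,
    16159699728, 10723374704, 10734994800, 66846944, 16169043712, 67106816]

/-- The entries of the matrix with rows `generatorRows`. -/
def generatorBit (i j : Fin 34) : Bool := (generatorRows.getD i 0).testBit j
section Pack

variable {α : Type*}

/-- The natural number whose binary digits, lowest first, are the values of `f` along a list. -/
def pack (f : α → Bool) : List α → ℕ
  | [] => 0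
  | a :: L => Nat.bit (f a) (pack f L)

theorem pack_false (L : List α) : pack (fun _ => false) L = 0 := by
  induction L with
  | nil => rfl
  | cons a L ih => simp [pack, ih]

theorem pack_true (L : List α) : pack (fun _ => true) L = 2 ^ L.length - 1 := by
  induction L with
  | nil => rfl
  | cons a L ih =>
    have := Nat.one_le_two_pow (n := L.length)
    simp only [pack, ih, List.length_cons, pow_succ, Nat.bit_val, Bool.toNat_true]
    omega

theorem pack_xor (f g : α → Bool) (L : List α) :
    pack f L ^^^ pack g L = pack (fun a => f a ^^ g a) L := by
  induction L with
  | nil => simp [pack]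
  | cons a L ih => simp [pack, Nat.xor_bit, ih]

theorem pack_and (f g : α → Bool) (L : List α) :
    pack f L &&& pack g L = pack (fun a => f a && g a) L := by
  induction L with
  | nil => simp [pack]
  | cons a L ih => simp [pack, Nat.land_bit, ih]

theorem pack_append (f : α → Bool) (L M : List α) :
    pack f (L ++ M) = pack f L ||| pack f M <<< L.length := by
  induction L with
  | nil => simp [pack]
  | cons a L ih =>
    have h : pack f M <<< (L.length + 1) = Nat.bit false (pack f M <<< L.length) := by
      simp [Nat.shiftLeft_eq, pow_succ, Nat.bit_val]; ring
    rw [List.cons_append, pack, ih, pack, List.length_cons, h, Nat.lor_bit, Bool.or_false]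

theorem pack_map {β : Type*} (f : β → Bool) (g : α → β) (L : List α) :
    pack f (L.map g) = pack (fun a => f (g a)) L := by
  induction L with
  | nil => rfl
  | cons a L ih => simp [pack, ih]

theorem pack_lt (f : α → Bool) (L : List α) : pack f L < 2 ^ L.length := by
  induction L with
  | nil => simp [pack]
  | cons a L ih =>
    have : (f a).toNat ≤ 1 := Bool.toNat_le _
    simp only [pack, Nat.bit_val, List.length_cons, pow_succ]
    omega

end Pack

section PopCount

/-- The number of ones in the binary expansion. -/
def bitCount (x : ℕ) : ℕ := x.bits.count true

theorem bitCount_zero : bitCount 0 = 0 := by simp [bitCount]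

theorem bitCount_bit (b : Bool) (x : ℕ) : bitCount (Nat.bit b x) = b.toNat + bitCount x := by
  by_cases h : x = 0 → b = true
  · rw [bitCount, Nat.bits_append_bit _ _ h]
    cases b <;> simp [bitCount, add_comm]
  · push Not at h
    obtain ⟨rfl, hb⟩ := h
    simp only [ne_eq, Bool.not_eq_true] at hb
    subst hb
    simp [bitCount]

theorem bitCount_pack {α : Type*} (f : α → Bool) (L : List α) :
    bitCount (pack f L) = L.countP f := by
  induction L with
  | nil => simp [pack, bitCount_zero]
  | cons a L ih =>
    rw [pack, bitCount_bit, ih, List.countP_cons, add_comm]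
    cases f a <;> simp

theorem bitCount_le (d x : ℕ) (h : x < 2 ^ d) : bitCount x ≤ d := by
  induction d generalizing x with
  | zero => simp_all [bitCount_zero]
  | succ d ih =>
    rw [← Nat.bit_bodd_div2 x, bitCount_bit]
    have h1 : x.div2 < 2 ^ d := by rw [Nat.div2_val]; omega
    have := ih _ h1
    have : x.bodd.toNat ≤ 1 := Bool.toNat_le _
    omega

theorem bitCount_and_pred (x : ℕ) (h : x ≠ 0) : bitCount x = bitCount (x &&& (x - 1)) + 1 := by
  induction x using Nat.binaryRec with
  | zero => exact absurd rfl h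
  | bit b y ih =>
    cases b
    · have hy : y ≠ 0 := by rintro rfl; exact h rfl
      have : Nat.bit false y - 1 = Nat.bit true (y - 1) := by
        simp only [Nat.bit_val, Bool.toNat_false, Bool.toNat_true]; omega
      rw [this, Nat.land_bit, bitCount_bit, bitCount_bit, ih hy]
      simp
    · have : Nat.bit true y - 1 = Nat.bit false y := by simp [Nat.bit_val]
      rw [this, Nat.land_bit, bitCount_bit, bitCount_bit]
      simp [add_comm]

theorem bitCount_shiftRight_add_mod (s x : ℕ) :
    bitCount (x >>> s) + bitCount (x % 2 ^ s) = bitCount x := by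
  induction s generalizing x with
  | zero => simp [Nat.mod_one, bitCount_zero]
  | succ s ih =>
    have h1 : x >>> (s + 1) = x.div2 >>> s := by
      rw [Nat.div2_val, add_comm, Nat.shiftRight_add]; rfl
    have h2 : x % 2 ^ (s + 1) = Nat.bit x.bodd (x.div2 % 2 ^ s) := by
      rw [Nat.bit_val, Nat.div2_val, pow_succ, mul_comm, Nat.mod_mul, Nat.mod_two_of_bodd]
      ring
    conv_rhs => rw [← Nat.bit_bodd_div2 x, bitCount_bit, ← ih]
    rw [h1, h2, bitCount_bit]
    ring

theorem xor_shiftRight_shiftLeft (x s : ℕ) : x ^^^ ((x >>> s) <<< s) = x % 2 ^ s := by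
  apply Nat.eq_of_testBit_eq
  intro i
  simp only [Nat.testBit_xor, Nat.testBit_shiftLeft, Nat.testBit_shiftRight,
    Nat.testBit_mod_two_pow]
  by_cases h : i < s
  · simp [h, Nat.not_le.2 h]
  · simp [h, Nat.not_lt.1 h]

theorem clearCount_eq (d x : ℕ) (h : bitCount x ≤ d) : clearCount d x = bitCount x := by
  induction d generalizing x with
  | zero => rw [clearCount]; omega
  | succ d ih =>
    by_cases hx : x = 0
    · simp [clearCount, hx, bitCount_zero]
    · have := bitCount_and_pred x hx
      rw [clearCount, beq_eq_false_iff_ne.2 hx, cond_false, ih _ (by omega), this]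

theorem popCount_eq (d x : ℕ) (h : x < 2 ^ 2 ^ (d + 12)) : popCount d x = bitCount x := by
  induction d generalizing x with
  | zero => exact clearCount_eq _ _ (bitCount_le (2 ^ (0 + 12)) _ h)
  | succ d ih =>
    by_cases hx : x = 0
    · simp [popCount, hx, bitCount_zero]
    · have h1 : x >>> 2 ^ (d + 12) < 2 ^ 2 ^ (d + 12) := by
        rw [Nat.shiftRight_eq_div_pow, Nat.div_lt_iff_lt_mul (by positivity), ← pow_add]
        convert h using 2
        ring
      simp only [popCount, beq_iff_eq, hx, cond_eq_ite, if_false, xor_shiftRight_shiftLeft]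
      rw [ih _ h1, ih _ (Nat.mod_lt _ (by positivity)), bitCount_shiftRight_add_mod]

end PopCount

section Slices

variable {α : Type*}

theorem combinationSlice_eq {ι : Type*} (b : ι → Bool) (l : List ι) (k : ℕ) :
    combinationSlice b l k = pack (fun s => (s.map b).foldr xor false) (l.sublistsLen k) := by
  induction l generalizing k with
  | nil => cases k <;> simp [combinationSlice, pack]
  | cons i l ih =>
    cases k with
    | zero => simp [combinationSlice, pack]
    | succ k =>
      have h : (bif b i then 2 ^ (l.length.descFactorial k / k !) - 1 else 0) =
          pack (fun _ => b i) (l.sublistsLen k) := by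
        cases b i
        · simp [pack_false]
        · simp [pack_true, Nat.choose_eq_descFactorial_div_factorial]
      rw [combinationSlice, List.sublistsLen_succ_cons, pack_append, pack_map, ih, ih, h, pack_xor,
        List.length_sublistsLen, Nat.choose_eq_descFactorial_div_factorial]
      simp [Bool.xor_comm]

/-- The number with given binary digits, lowest first. -/
def digitValue (F : List (α → Bool)) (a : α) : ℕ :=
  F.foldr (fun f m => (f a).toNat + 2 * m) 0

theorem digitValue_cons (f : α → Bool) (F : List (α → Bool)) (a : α) :
    digitValue (f :: F) a = (f a).toNat + 2 * digitValue F a := rfl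

theorem exists_addSlice (L : List α) (F : List (α → Bool)) (f : α → Bool) :
    ∃ G : List (α → Bool), addSlice (F.map (pack · L)) (pack f L) = G.map (pack · L) ∧
      ∀ a ∈ L, digitValue G a = digitValue F a + (f a).toNat := by
  induction F generalizing f with
  | nil =>
    by_cases h : pack f L = 0
    · refine ⟨[], by simp [addSlice, h], fun a ha => ?_⟩
      have := bitCount_pack f L
      rw [h, bitCount_zero, eq_comm, List.countP_eq_zero] at this
      simp [digitValue, this a ha]
    · exact ⟨[f], by simp [addSlice, beq_eq_false_iff_ne.2 h], fun a _ => by simp [digitValue]⟩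
  | cons g F ih =>
    obtain ⟨G, h1, h2⟩ := ih fun a => g a && f a
    refine ⟨(fun a => g a ^^ f a) :: G, by simp [addSlice, pack_xor, pack_and, h1], fun a ha => ?_⟩
    have := h2 a ha
    rw [digitValue_cons, digitValue_cons, this]
    cases g a <;> cases f a <;> simp <;> ring

theorem exists_foldl_addSlice (L : List α) (S F : List (α → Bool)) :
    ∃ G : List (α → Bool),
      (S.map (pack · L)).foldl addSlice (F.map (pack · L)) = G.map (pack · L) ∧
      ∀ a ∈ L, digitValue G a = digitValue F a + S.countP (· a) := by
  induction S generalizing F with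
  | nil => exact ⟨F, by simp⟩
  | cons f S ih =>
    obtain ⟨F', h1, h2⟩ := exists_addSlice L F f
    obtain ⟨G, h3, h4⟩ := ih F'
    refine ⟨G, by simp [h1, h3], fun a ha => ?_⟩
    rw [h4 a ha, h2 a ha, List.countP_cons]
    cases f a <;> simp [add_assoc, add_comm 1]

theorem eqMask_eq (L : List α) (F : List (α → Bool)) (o : ℕ) :
    eqMask (2 ^ L.length - 1) (F.map (pack · L)) o =
      pack (fun a => decide (digitValue F a = o)) L := by
  rw [← pack_true]
  induction F generalizing o with
  | nil =>
    by_cases h : o = 0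
    · simp [eqMask, digitValue, h]
    · simp [eqMask, digitValue, beq_eq_false_iff_ne.2 h, Ne.symm h, pack_false]
  | cons f F ih =>
    have h : (bif o % 2 == 0 then pack f L ^^^ pack (fun _ => true) L else pack f L) =
        pack (fun a => f a ^^ decide (o % 2 = 0)) L := by
      rcases Nat.mod_two_eq_zero_or_one o with h | h <;> simp [h, pack_xor]
    rw [List.map_cons, eqMask, ih, h, pack_and]
    congr 1
    funext a
    rw [digitValue_cons, Bool.eq_iff_iff]
    cases f a <;> simp <;> omega

end Slices

section Matrix

variable {n : ℕ}

theorem combinationCount_eq (B : Fin n → Fin n → Bool) (k o : ℕ) :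
    combinationCount B k o = ((List.finRange n).sublistsLen k).countP fun s =>
      decide ((List.finRange n).countP (fun j => (s.map (B · j)).foldr xor false) = o) := by
  set L := (List.finRange n).sublistsLen k
  have hlen : n.descFactorial k / k ! = L.length := by
    rw [List.length_sublistsLen, List.length_finRange, Nat.choose_eq_descFactorial_div_factorial]
  obtain ⟨G, h1, h2⟩ := exists_foldl_addSlice L
    ((List.finRange n).map fun j s => (s.map (B · j)).foldr xor false) []
  have h3 : ((List.finRange n).map fun j => combinationSlice (B · j) (List.finRange n) k) =
      ((List.finRange n).map fun j s => (s.map (B · j)).foldr xor false).map (pack · L) := by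
    simp [combinationSlice_eq, L, Function.comp_def]
  rw [List.map_nil] at h1
  rw [combinationCount, h3, h1, hlen, eqMask_eq, popCount_eq, bitCount_pack]
  · refine List.countP_congr fun s hs => ?_
    simp only [decide_eq_true_eq]
    rw [h2 s hs, List.countP_map]
    simp [digitValue, Function.comp_def]
  · refine (pack_lt _ _).trans (Nat.pow_lt_pow_right one_lt_two ?_)
    exact (Nat.lt_log2_self).trans_le (Nat.pow_le_pow_right two_pos (by omega))

/-- The matrix over `ZMod 2` with given bits. -/
def bitMatrix (B : Fin n → Fin n → Bool) : Matrix (Fin n) (Fin n) (ZMod 2) :=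
  Matrix.of fun i j => bif B i j then 1 else 0

theorem sum_map_cond {ι : Type*} (b : ι → Bool) (l : List ι) :
    (l.map fun i => (bif b i then 1 else 0 : ZMod 2)).sum =
      bif (l.map b).foldr xor false then 1 else 0 := by
  induction l with
  | nil => rfl
  | cons i l ih =>
    rw [List.map_cons, List.sum_cons, ih, List.map_cons, List.foldr_cons]
    cases b i <;> cases (l.map b).foldr xor false <;> rfl

theorem hammingNorm_eq_countP (x : Fin n → ZMod 2) :
    hammingNorm x = (List.finRange n).countP fun j => decide (x j ≠ 0) := by
  rw [hammingNorm, Finset.card, Finset.filter_val, Fin.univ_def, Multiset.filter_coe,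
    Multiset.coe_card, List.countP_eq_length_filter]

/-- The number of vectors of weight `k` that the matrix sends to vectors of weight `o`. -/
def pairCount (A : Matrix (Fin n) (Fin n) (ZMod 2)) (k o : ℕ) : ℕ :=
  (Finset.univ.filter fun x : Fin n → ZMod 2 =>
    hammingNorm x = k ∧ hammingNorm (Matrix.vecMul x A) = o).card

theorem vecMul_eq_sum_support (x : Fin n → ZMod 2) (A : Matrix (Fin n) (Fin n) (ZMod 2)) :
    Matrix.vecMul x A = ∑ i with x i ≠ 0, A.row i := by
  rw [Matrix.vecMul_eq_sum, Finset.sum_filter]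
  refine Finset.sum_congr rfl fun i _ => ?_
  have h : ∀ c : ZMod 2, c = 0 ∨ c = 1 := by decide
  rcases h (x i) with h | h <;> simp [h, Matrix.row]

theorem hammingNorm_sum_row (B : Fin n → Fin n → Bool) (s : List (Fin n)) :
    hammingNorm (s.map (bitMatrix B).row).sum =
      (List.finRange n).countP fun j => (s.map (B · j)).foldr xor false := by
  rw [hammingNorm_eq_countP]
  refine List.countP_congr fun j _ => ?_
  have : (s.map (bitMatrix B).row).sum j =
      (s.map fun i => (bif B i j then 1 else 0 : ZMod 2)).sum := by
    rw [Pi.list_sum_apply, List.map_map]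
    rfl
  rw [this, sum_map_cond]
  cases (s.map (B · j)).foldr xor false <;> simp

theorem pairCount_bitMatrix (B : Fin n → Fin n → Bool) (k o : ℕ) :
    pairCount (bitMatrix B) k o = combinationCount B k o := by
  let Q (m : Multiset (Fin n)) : Prop := hammingNorm (m.map (bitMatrix B).row).sum = o
  have h1 : pairCount (bitMatrix B) k o =
      ((Finset.powersetCard k Finset.univ).filter fun s : Finset (Fin n) => Q s.val).card := by
    refine Finset.card_bij (fun x _ => Finset.univ.filter (x · ≠ 0)) ?_ ?_ ?_
    · intro x hx
      rw [Finset.mem_filter, vecMul_eq_sum_support] at hx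
      exact Finset.mem_filter.2
        ⟨Finset.mem_powersetCard.2 ⟨Finset.subset_univ _, hx.2.1⟩, hx.2.2⟩
    · intro x _ y _ hxy
      have h : ∀ c d : ZMod 2, (c ≠ 0 ↔ d ≠ 0) → c = d := by decide
      funext i
      exact h _ _ (by simpa using Finset.ext_iff.1 hxy i)
    · intro s hs
      have hsupp : Finset.univ.filter (fun i => (if i ∈ s then 1 else 0 : ZMod 2) ≠ 0) = s := by
        ext i
        simp
      rw [Finset.mem_filter, Finset.mem_powersetCard] at hs
      refine ⟨fun i => if i ∈ s then 1 else 0, Finset.mem_filter.2 ⟨Finset.mem_univ _, ?_, ?_⟩,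
        hsupp⟩
      · rw [hammingNorm, hsupp, hs.1.2]
      · rw [vecMul_eq_sum_support, hsupp]
        exact hs.2
  have h2 : ((Finset.powersetCard k Finset.univ).filter fun s : Finset (Fin n) => Q s.val).card =
      (Multiset.powersetCard k (List.finRange n : Multiset (Fin n))).countP Q := by
    have : (List.finRange n : Multiset (Fin n)) = (Finset.univ : Finset (Fin n)).val := rfl
    rw [this, ← Finset.map_val_val_powersetCard, Multiset.countP_map]
    rfl
  rw [h1, h2, combinationCount_eq, Multiset.powersetCard_coe, Multiset.coe_countP, List.countP_map]
  refine List.countP_congr fun s _ => ?_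
  rw [← hammingNorm_sum_row]
  rfl

theorem pairCount_transpose (A : Matrix (Fin n) (Fin n) (ZMod 2)) (hA : A * A.transpose = 1)
    (k o : ℕ) : pairCount A.transpose k o = pairCount A o k := by
  have hA' := mul_eq_one_comm.1 hA
  refine Finset.card_bij' (fun x _ => Matrix.vecMul x A.transpose) (fun x _ => Matrix.vecMul x A)
    ?_ ?_ ?_ ?_ <;> simp +contextual [Matrix.vecMul_vecMul, hA, hA']

/-- The linear code with generator matrix `(1 | A)`. -/
def systematicCode (A : Matrix (Fin n) (Fin n) (ZMod 2)) :
    Submodule (ZMod 2) (Fin (n + n) → ZMod 2) where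
  carrier := {v | ∃ x, v = Fin.append x (Matrix.vecMul x A)}
  zero_mem' := ⟨0, by ext i; refine Fin.addCases ?_ ?_ i <;> simp [-Fin.natAdd_eq_addNat]⟩
  add_mem' := by
    rintro _ _ ⟨x, rfl⟩ ⟨y, rfl⟩
    exact ⟨x + y, by
      ext i; refine Fin.addCases ?_ ?_ i <;> simp [-Fin.natAdd_eq_addNat, Matrix.add_vecMul]⟩
  smul_mem' := by
    rintro c _ ⟨x, rfl⟩
    exact ⟨c • x, by
      ext i; refine Fin.addCases ?_ ?_ i <;> simp [-Fin.natAdd_eq_addNat, Matrix.smul_vecMul]⟩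

variable (A : Matrix (Fin n) (Fin n) (ZMod 2))

theorem mem_systematicCode {v : Fin (n + n) → ZMod 2} :
    v ∈ systematicCode A ↔ ∃ x, v = Fin.append x (Matrix.vecMul x A) := Iff.rfl

theorem append_vecMul_injective :
    Function.Injective fun x : Fin n → ZMod 2 => Fin.append x (Matrix.vecMul x A) :=
  fun x y h => by ext i; simpa using congrFun h (Fin.castAdd n i)

theorem finrank_systematicCode : Module.finrank (ZMod 2) (systematicCode A) = n := by
  let f : (Fin n → ZMod 2) ≃ systematicCode A :=
    Equiv.ofBijective (fun x => ⟨_, x, rfl⟩)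
      ⟨fun x y h => append_vecMul_injective A (congrArg Subtype.val h),
        fun ⟨_, x, h⟩ => ⟨x, Subtype.ext h.symm⟩⟩
  have := Fintype.ofEquiv _ f
  have h := Module.card_eq_pow_finrank (K := ZMod 2) (V := systematicCode A)
  rw [← Fintype.card_congr f] at h
  simp only [Fintype.card_fun, Fintype.card_fin, ZMod.card] at h
  exact (Nat.pow_right_injective le_rfl h).symm

theorem systematicCode_eq_dualCode (hA : A * A.transpose = 1) :
    systematicCode A = dualCode (systematicCode A) := by
  have hadd (a b : Fin n → ZMod 2) : a + b = 0 ↔ a = b := by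
    simp [funext_iff, CharTwo.add_eq_zero]
  have hmem (w : Fin (n + n) → ZMod 2) : w ∈ dualCode (systematicCode A) ↔
      (fun i => w (Fin.castAdd n i)) = Matrix.mulVec A (fun i => w (Fin.natAdd n i)) := by
    rw [← hadd, ← dotProduct_eq_zero_iff]
    have : w ∈ dualCode (systematicCode A) ↔
        ∀ v ∈ systematicCode A, ∑ i, v i * w i = 0 := Iff.rfl
    rw [this]
    constructor
    · intro h x
      have := h _ ⟨x, rfl⟩
      rw [Fin.sum_univ_add] at this
      rw [dotProduct_comm, dotProduct_add, Matrix.dotProduct_mulVec]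
      simpa [dotProduct, -Fin.natAdd_eq_addNat] using this
    · rintro h _ ⟨x, rfl⟩
      have := h x
      rw [dotProduct_comm, dotProduct_add, Matrix.dotProduct_mulVec] at this
      rw [Fin.sum_univ_add]
      simpa [dotProduct, -Fin.natAdd_eq_addNat] using this
  ext w
  rw [hmem, mem_systematicCode]
  constructor
  · rintro ⟨x, rfl⟩
    simp only [Fin.append_left, Fin.append_right]
    rw [← Matrix.vecMul_transpose, Matrix.vecMul_vecMul, hA, Matrix.vecMul_one]
  · intro h
    refine ⟨fun i => w (Fin.castAdd n i), ?_⟩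
    have h' := congrArg (Matrix.vecMul · A) h
    simp only [← Matrix.vecMul_transpose, Matrix.vecMul_vecMul, mul_eq_one_comm.1 hA,
      Matrix.vecMul_one] at h'
    rw [h']
    ext i
    refine Fin.addCases ?_ ?_ i <;> simp [-Fin.natAdd_eq_addNat]

theorem hammingNorm_append (x y : Fin n → ZMod 2) :
    hammingNorm (Fin.append x y) = hammingNorm x + hammingNorm y := by
  simp [hammingNorm, Finset.card_filter, Fin.sum_univ_add, -Fin.natAdd_eq_addNat]

theorem ncard_systematicCode_eq_sum (w : ℕ) :
    {v | v ∈ systematicCode A ∧ hammingNorm v = w}.ncard =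
      ∑ k ∈ Finset.range (w + 1), pairCount A k (w - k) := by
  have : {v | v ∈ systematicCode A ∧ hammingNorm v = w} =
      (fun x : Fin n → ZMod 2 => Fin.append x (Matrix.vecMul x A)) ''
        ((Finset.univ.filter fun x : Fin n → ZMod 2 =>
          hammingNorm x + hammingNorm (Matrix.vecMul x A) = w : Finset _) : Set _) := by
    ext v
    simp only [Set.mem_ofPred_eq, mem_systematicCode, Set.mem_image, Finset.coe_filter,
      Finset.mem_univ, true_and, ← hammingNorm_append]
    constructor
    · rintro ⟨⟨x, rfl⟩, h⟩
      exact ⟨x, h, rfl⟩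
    · rintro ⟨x, h, rfl⟩
      exact ⟨⟨x, rfl⟩, h⟩
  rw [this, Set.ncard_image_of_injective _ (append_vecMul_injective A), Set.ncard_coe_finset,
    Finset.card_eq_sum_card_fiberwise (f := hammingNorm) (t := Finset.range (w + 1))]
  · refine Finset.sum_congr rfl fun k hk => ?_
    rw [Finset.filter_filter, pairCount]
    congr 1
    ext x
    simp only [Finset.mem_range, Finset.mem_filter, Finset.mem_univ, true_and] at hk ⊢
    omega
  · intro x hx
    have : hammingNorm x + hammingNorm (Matrix.vecMul x A) = w := (Finset.mem_filter.1 hx).2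
    have hlt : hammingNorm x < w + 1 := by omega
    exact Finset.mem_coe.2 (Finset.mem_range.2 hlt)

theorem ncard_systematicCode_bitMatrix (B : Fin n → Fin n → Bool)
    (hB : bitMatrix B * (bitMatrix B).transpose = 1) (w : ℕ) :
    {v | v ∈ systematicCode (bitMatrix B) ∧ hammingNorm v = w}.ncard = weightCount B w := by
  have hw : w + 1 = (w / 2 + 1) + (w - w / 2) := by omega
  rw [ncard_systematicCode_eq_sum, hw, Finset.sum_range_add, weightCount]
  congr 1
  · simp [pairCount_bitMatrix, Finset.sum_range, Fin.sum_univ_def, ← List.map_coe_finRange_eq_range,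
      Function.comp_def]
  · rw [← Finset.sum_range_reflect]
    have (k : ℕ) : combinationCount (fun i j => B j i) k (w - k) =
        pairCount (bitMatrix B) (w - k) k := by
      rw [← pairCount_transpose _ hB, ← pairCount_bitMatrix]
      rfl
    simp only [this]
    rw [← List.sum_toFinset _ List.nodup_range, List.toFinset_range]
    refine Finset.sum_congr rfl fun k hk => ?_
    rw [Finset.mem_range] at hk
    congr 1 <;> omega

theorem bitMatrix_mul_transpose (B : Fin n → Fin n → Bool)
    (h : ∀ i k, ((List.finRange n).map fun j => B i j && B k j).foldr xor false = decide (i = k)) :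
    bitMatrix B * (bitMatrix B).transpose = 1 := by
  ext i k
  have h1 (j : Fin n) : bitMatrix B i j * bitMatrix B k j = bif B i j && B k j then 1 else 0 := by
    simp only [bitMatrix, Matrix.of_apply]
    cases B i j <;> cases B k j <;> rfl
  simp only [Matrix.mul_apply, Matrix.transpose_apply, h1, Fin.sum_univ_def, sum_map_cond, h,
    Matrix.one_apply]
  by_cases hik : i = k <;> simp [hik]

end Matrix

theorem generatorBit_orthonormal (i k : Fin 34) :
    ((List.finRange 34).map fun j => generatorBit i j && generatorBit k j).foldr xor false =
      decide (i = k) := by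
  revert i k
  decide +kernel

theorem weightCount_generatorBit_of_lt :
    ∀ w < 12, 0 < w → weightCount generatorBit w = 0 := by
  decide +kernel

theorem weightCount_generatorBit_twelve : weightCount generatorBit 12 = 1202 := by
  decide +kernel

theorem weightCount_generatorBit_fourteen : weightCount generatorBit 14 = 12416 := by
  decide +kernel

theorem stmt14 : ∃ C : Submodule (ZMod 2) (Fin 68 → ZMod 2),
    C = dualCode C ∧
    Module.finrank (ZMod 2) C = 34 ∧
    (∀ v ∈ C, v ≠ 0 → 12 ≤ hammingNorm v) ∧
    (∃ v ∈ C, hammingNorm v = 12) ∧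
    {v : Fin 68 → ZMod 2 | v ∈ C ∧ hammingNorm v = 12}.ncard = 1202 ∧
    {v : Fin 68 → ZMod 2 | v ∈ C ∧ hammingNorm v = 14}.ncard = 12416 := by
  have hA := bitMatrix_mul_transpose generatorBit generatorBit_orthonormal
  have hcount := ncard_systematicCode_bitMatrix generatorBit hA
  have h12 := (hcount 12).trans weightCount_generatorBit_twelve
  have hfinrank := finrank_systematicCode (bitMatrix generatorBit)
  refine ⟨systematicCode (bitMatrix generatorBit), systematicCode_eq_dualCode _ hA,
    hfinrank, fun v hv hv0 => ?_, ?_, h12,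
    (hcount 14).trans weightCount_generatorBit_fourteen⟩
  · by_contra! hlt
    have h := (hcount (hammingNorm v)).trans
      (weightCount_generatorBit_of_lt _ hlt (hammingNorm_pos_iff.2 hv0))
    rw [Set.ncard_eq_zero] at h
    exact Set.eq_empty_iff_forall_notMem.1 h v ⟨hv, rfl⟩
  · obtain ⟨v, hv⟩ := Set.nonempty_of_ncard_ne_zero (h12.trans_ne (by norm_num))
    exact ⟨v, hv⟩
end

section
/- There exists a binary self-dual code C ⊆ (ZMod 2)^{80} of dimension 40 whose minimum nonzero Hamming weight is 14, such that the number of codewords of Hamming weight 14 is 2816 and the number of codewords of Hamming weight 16 is 48669 (i.e. C is a self-dual [80,40,14] code with weight enumerator W_{80,2} for α = −96, β = 1). -/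
namespace BitSliced

/-- The number with binary expansion `1⋯1` (`n` ones). -/
def ones (n : ℕ) : ℕ := Nat.sub (Nat.shiftLeft 1 n) 1

/-- Add the constant word with bits `c` to every lane of a bit-sliced block of words:
slice `k` is complemented if bit `k` of `c` is set. -/
def addConst (full : ℕ) : ℕ → List ℕ → List ℕ
  | _, [] => []
  | c, s :: ss =>
    (bif Nat.beq (Nat.mod c 2) 1 then Nat.xor s full else s) :: addConst full (Nat.div c 2) ss

/-- Concatenate two blocks. A block `(n, ss)` holds `n` words; bit `i` of the `k`-th entry of `ss`
is the `k`-th coordinate of the `i`-th word. -/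
def append (p q : ℕ × List ℕ) : ℕ × List ℕ :=
  (Nat.add p.1 q.1, List.zipWith (fun a b => Nat.lor a (Nat.shiftLeft b p.1)) p.2 q.2)

/-- Add the word `r` to all words of a block. -/
def translate (r : ℕ) (p : ℕ × List ℕ) : ℕ × List ℕ :=
  (p.1, addConst (ones p.1) r p.2)

/-- From the blocks of sums of `k, k - 1, …, 0` rows, compute those with one more row available. -/
def step (r : ℕ) : List (ℕ × List ℕ) → List (ℕ × List ℕ)
  | [] => []
  | [p] => [p]
  | p :: q :: t => append p (translate r q) :: step r (q :: t)

/-- The blocks of all sums of `k, k - 1, …, 0` of the given rows. -/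
def table (k : ℕ) : List ℕ → List (ℕ × List ℕ)
  | [] => List.replicate k (0, List.replicate 40 0) ++ [(1, List.replicate 40 0)]
  | r :: rs => step r (table k rs)

/-- Carry-save addition: add up one-bit slices, returning the sum slice and the carry slices. -/
def carrySave : ℕ → List ℕ → List ℕ → ℕ × List ℕ
  | a, [], acc => (a, acc)
  | a, [b], acc => (Nat.xor a b, Nat.land a b :: acc)
  | a, b :: c :: l, acc =>
    carrySave (Nat.xor (Nat.xor a b) c) l
      (Nat.lor (Nat.land a b) (Nat.land (Nat.xor a b) c) :: acc)

/-- The binary digits of the lane-wise sum of a list of slices. -/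
def planes : ℕ → List ℕ → List ℕ
  | 0, _ => []
  | _ + 1, [] => []
  | k + 1, a :: l => (carrySave a l []).1 :: planes k (carrySave a l []).2

/-- The lanes whose value, given by binary digit slices, is `j`. -/
def eqMask (full : ℕ) : List ℕ → ℕ → ℕ
  | [], j => bif Nat.beq j 0 then full else 0
  | s :: ps, j =>
    Nat.land (bif Nat.beq (Nat.mod j 2) 1 then s else Nat.xor s full)
      (eqMask full ps (Nat.div j 2))

/-- The number of ones in the binary expansion of `x < 2 ^ 2 ^ k`. -/
def popCount : ℕ → ℕ → ℕ
  | 0, x => x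
  | k + 1, x => bif Nat.beq x 0 then 0 else
      Nat.add
        (popCount k
          (Nat.sub x (Nat.shiftLeft (Nat.shiftRight x (Nat.pow 2 k)) (Nat.pow 2 k))))
        (popCount k (Nat.shiftRight x (Nat.pow 2 k)))

/-- For each `j` in `js`, the number of words in a block translated by `c` of weight `j`. -/
def blockCount (js : List ℕ) (p : ℕ × List ℕ) (c : ℕ) : List ℕ :=
  let ps := planes 6 (addConst (ones p.1) c p.2)
  js.map fun j => popCount (Nat.add (Nat.log2 p.1) 1) (eqMask (ones p.1) ps j)

/-- Branch over the subsets of a list of further rows, evaluating a block in each branch. -/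
def branchCount (js : List ℕ) : List ℕ → List (ℕ × List ℕ) → ℕ → List ℕ
  | _, [], _ => []
  | _, [p], c => blockCount js p c
  | [], p :: _ :: _, c => blockCount js p c
  | o :: os, p :: q :: t, c =>
    List.zipWith Nat.add (branchCount js os (p :: q :: t) c)
      (branchCount js os (q :: t) (Nat.xor c o))

/-- The weight of the `i`-th word of the block with slices `ss`, translated by `c`. -/
def laneWeight : List ℕ → ℕ → ℕ → ℕ
  | [], _, _ => 0
  | s :: ss, i, c => (s.testBit i ^^ c.testBit 0).toNat + laneWeight ss i (c / 2)

/-- The weight of the word of length `40` with bits `c`. -/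
def weight (c : ℕ) : ℕ := laneWeight (List.replicate 40 0) 0 c

/-- The number of `k`-subsets of the rows whose sum, translated by `c`, has weight `j`. -/
def sumCount (j : ℕ) : List ℕ → ℕ → ℕ → ℕ
  | _, 0, c => if weight c = j then 1 else 0
  | [], _ + 1, _ => 0
  | r :: rs, k + 1, c => sumCount j rs (k + 1) c + sumCount j rs k (c ^^^ r)

/-- The number of words of weight `j` in a block translated by `c`. -/
def laneCount (p : ℕ × List ℕ) (c j : ℕ) : ℕ :=
  ((List.range p.1).countP fun i => laneWeight p.2 i c = j)

/-- The block consists of the sums of `k` of the rows. -/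
structure Represents (p : ℕ × List ℕ) (rows : List ℕ) (k : ℕ) : Prop where
  length_eq : p.2.length = 40
  testBit_eq_false : ∀ s ∈ p.2, ∀ i, p.1 ≤ i → s.testBit i = false
  laneCount_eq : ∀ c j, laneCount p c j = sumCount j rows k c

/-- The list consists of the blocks of sums of `k, k - 1, …, 0` of the rows. -/
def RepresentsAll (rows : List ℕ) : ℕ → List (ℕ × List ℕ) → Prop
  | 0, [p] => Represents p rows 0
  | k + 1, p :: t => Represents p rows (k + 1) ∧ RepresentsAll rows k t
  | _, _ => False

theorem testBit_ones (n i : ℕ) : (ones n).testBit i = decide (i < n) := by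
  have : ones n = 2 ^ n - 1 := by
    change 1 <<< n - 1 = _
    rw [Nat.one_shiftLeft]
  rw [this, Nat.testBit_two_pow_sub_one]

theorem beq_mod_two (c : ℕ) : Nat.beq (Nat.mod c 2) 1 = c.testBit 0 := by
  rw [Nat.testBit_zero, Bool.eq_iff_iff, Nat.beq_eq, decide_eq_true_iff]
  rfl

theorem length_addConst (full : ℕ) (ss : List ℕ) (c : ℕ) :
    (addConst full c ss).length = ss.length := by
  induction ss generalizing c with
  | nil => rfl
  | cons s ss ih => simp [addConst, ih]

theorem testBit_addConst (n : ℕ) (ss : List ℕ) (c : ℕ)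
    (h : ∀ s ∈ ss, ∀ i, n ≤ i → s.testBit i = false) :
    ∀ s ∈ addConst (ones n) c ss, ∀ i, n ≤ i → s.testBit i = false := by
  induction ss generalizing c with
  | nil => simp [addConst]
  | cons s ss ih =>
    simp only [addConst, List.mem_cons, forall_eq_or_imp] at h ⊢
    refine ⟨fun i hi => ?_, ih _ h.2⟩
    cases Nat.beq (Nat.mod c 2) 1
    · exact h.1 i hi
    · change (s ^^^ ones n).testBit i = false
      simp [testBit_ones, h.1 i hi, hi]

theorem laneWeight_addConst (n i : ℕ) (hi : i < n) (ss : List ℕ) (r c : ℕ) :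
    laneWeight (addConst (ones n) r ss) i c = laneWeight ss i (c ^^^ r) := by
  induction ss generalizing r c with
  | nil => rfl
  | cons s ss ih =>
    have hd : (c ^^^ r) / 2 = c / 2 ^^^ r / 2 := Nat.xor_div_two
    simp only [addConst, laneWeight, ih, beq_mod_two, hd, Nat.testBit_xor]
    congr 2
    cases h : r.testBit 0
    · simp
    · change ((s ^^^ ones n).testBit i ^^ _) = _
      simp only [Nat.testBit_xor, testBit_ones, hi, decide_true]
      cases s.testBit i <;> cases c.testBit 0 <;> rfl

theorem laneCount_translate (r : ℕ) (p : ℕ × List ℕ) (c j : ℕ) :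
    laneCount (translate r p) c j = laneCount p (c ^^^ r) j := by
  unfold laneCount translate
  refine List.countP_congr fun i hi => ?_
  rw [laneWeight_addConst _ _ (List.mem_range.1 hi)]

theorem laneWeight_zipWith_left (n i : ℕ) (hi : i < n) (as bs : List ℕ)
    (h : as.length = bs.length) (c : ℕ) :
    laneWeight (List.zipWith (fun a b => Nat.lor a (Nat.shiftLeft b n)) as bs) i c =
      laneWeight as i c := by
  induction as generalizing bs c with
  | nil => rfl
  | cons a as ih =>
    cases bs with
    | nil => simp at h
    | cons b bs =>
      simp only [List.zipWith_cons_cons, laneWeight]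
      rw [ih bs (by simpa using h)]
      congr 3
      change (a ||| b <<< n).testBit i = _
      simp [Nat.testBit_shiftLeft, hi]

theorem laneWeight_zipWith_right (n i : ℕ) (as bs : List ℕ)
    (h : as.length = bs.length) (ha : ∀ s ∈ as, ∀ i, n ≤ i → s.testBit i = false) (c : ℕ) :
    laneWeight (List.zipWith (fun a b => Nat.lor a (Nat.shiftLeft b n)) as bs) (n + i) c =
      laneWeight bs i c := by
  induction as generalizing bs c with
  | nil =>
    cases bs with
    | nil => rfl
    | cons b bs => simp at h
  | cons a as ih =>
    cases bs with
    | nil => simp at h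
    | cons b bs =>
      simp only [List.mem_cons, forall_eq_or_imp] at ha
      simp only [List.zipWith_cons_cons, laneWeight]
      rw [ih bs (by simpa using h) ha.2]
      congr 3
      change (a ||| b <<< n).testBit (n + i) = _
      simp [Nat.testBit_shiftLeft, ha.1 (n + i)]

theorem laneCount_append (p q : ℕ × List ℕ) (h : p.2.length = q.2.length)
    (hp : ∀ s ∈ p.2, ∀ i, p.1 ≤ i → s.testBit i = false) (c j : ℕ) :
    laneCount (append p q) c j = laneCount p c j + laneCount q c j := by
  unfold laneCount append
  change List.countP _ (List.range (p.1 + q.1)) = _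
  rw [List.range_add, List.countP_append, List.countP_map]
  congr 1
  · refine List.countP_congr fun i hi => ?_
    rw [laneWeight_zipWith_left _ _ (List.mem_range.1 hi) _ _ h]
  · refine List.countP_congr fun i _ => ?_
    simp only [Function.comp_apply]
    rw [laneWeight_zipWith_right _ _ _ _ h hp]

theorem testBit_append (p q : ℕ × List ℕ)
    (hp : ∀ s ∈ p.2, ∀ i, p.1 ≤ i → s.testBit i = false)
    (hq : ∀ s ∈ q.2, ∀ i, q.1 ≤ i → s.testBit i = false) :
    ∀ s ∈ (append p q).2, ∀ i, (append p q).1 ≤ i → s.testBit i = false := by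
  intro s hs i hi
  change p.1 + q.1 ≤ i at hi
  obtain ⟨k, hk, rfl⟩ := List.mem_iff_getElem.1 hs
  simp only [append, List.length_zipWith, lt_min_iff] at hk
  simp only [append, List.getElem_zipWith]
  change (p.2[k] ||| q.2[k] <<< p.1).testBit i = false
  simp [Nat.testBit_shiftLeft, hp _ (List.getElem_mem hk.1) i (by omega),
    hq _ (List.getElem_mem hk.2) (i - p.1) (by omega)]

theorem Represents.append_translate {p q : ℕ × List ℕ} {rows : List ℕ} {k : ℕ} (r : ℕ)
    (hp : Represents p rows (k + 1)) (hq : Represents q rows k) :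
    Represents (append p (translate r q)) (r :: rows) (k + 1) := by
  have hl : (translate r q).2.length = 40 := by
    simp [translate, length_addConst, hq.length_eq]
  refine ⟨?_, testBit_append _ _ hp.testBit_eq_false
    (testBit_addConst _ _ _ hq.testBit_eq_false), fun c j => ?_⟩
  · simp [append, hl, hp.length_eq]
  · rw [laneCount_append _ _ (hp.length_eq.trans hl.symm) hp.testBit_eq_false,
      laneCount_translate, hp.laneCount_eq, hq.laneCount_eq, sumCount]

theorem Represents.cons_zero {p : ℕ × List ℕ} {rows : List ℕ} (r : ℕ)
    (hp : Represents p rows 0) : Represents p (r :: rows) 0 :=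
  ⟨hp.length_eq, hp.testBit_eq_false, fun c j => by
    rw [hp.laneCount_eq]; cases rows <;> rfl⟩

theorem RepresentsAll.step {rows : List ℕ} (r : ℕ) {k : ℕ} {t : List (ℕ × List ℕ)}
    (h : RepresentsAll rows k t) : RepresentsAll (r :: rows) k (step r t) := by
  induction k generalizing t with
  | zero =>
    match t, h with
    | [p], h => exact Represents.cons_zero r h
  | succ k ih =>
    match t, h with
    | p :: q :: t, h =>
      refine ⟨h.1.append_translate r ?_, ih h.2⟩
      cases k with
      | zero =>
        cases t with
        | nil => exact h.2
        | cons _ _ => exact h.2.elim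
      | succ k => exact h.2.1
    | [p], h => cases k <;> exact h.2.elim

theorem representsAll_table (k : ℕ) (rows : List ℕ) : RepresentsAll rows k (table k rows) := by
  induction rows with
  | cons r rs ih => exact ih.step r
  | nil =>
    induction k with
    | zero =>
      refine ⟨rfl, fun s hs => ?_, fun c j => ?_⟩
      · simp [List.eq_of_mem_replicate hs]
      · by_cases h : weight c = j <;> simp_all [laneCount, sumCount, weight]
    | succ k ih =>
      refine ⟨⟨rfl, fun s hs => ?_, fun c j => ?_⟩, ih⟩
      · simp [List.eq_of_mem_replicate hs]
      · rfl

/-- The sum of the `i`-th bits of a list of slices. -/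
def laneSum (i : ℕ) (l : List ℕ) : ℕ := (l.map fun s => (s.testBit i).toNat).sum

theorem laneWeight_zero (ss : List ℕ) (i : ℕ) : laneWeight ss i 0 = laneSum i ss := by
  induction ss with
  | nil => rfl
  | cons s ss ih => simp [laneWeight, laneSum, ih]

theorem laneSum_carrySave (i a : ℕ) (l acc : List ℕ) :
    ((carrySave a l acc).1.testBit i).toNat + 2 * laneSum i (carrySave a l acc).2 =
      (a.testBit i).toNat + laneSum i l + 2 * laneSum i acc := by
  induction a, l, acc using carrySave.induct with
  | case1 a acc => simp [carrySave, laneSum]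
  | case2 a b acc =>
    change ((a ^^^ b).testBit i).toNat + 2 * laneSum i ((a &&& b) :: acc) = _
    simp only [laneSum, Nat.testBit_xor, Nat.testBit_land, List.map_cons, List.sum_cons,
      List.map_nil, List.sum_nil]
    cases a.testBit i <;> cases b.testBit i <;> simp +arith
  | case3 a b c l acc ih =>
    rw [carrySave, ih]
    change ((a ^^^ b ^^^ c).testBit i).toNat + _ +
      2 * laneSum i (((a &&& b) ||| ((a ^^^ b) &&& c)) :: acc) = _
    simp only [laneSum, Nat.testBit_xor, Nat.testBit_land, Nat.testBit_lor, List.map_cons,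
      List.sum_cons]
    cases a.testBit i <;> cases b.testBit i <;> cases c.testBit i <;> simp <;> omega

theorem length_carrySave (a : ℕ) (l acc : List ℕ) :
    (carrySave a l acc).2.length = acc.length + (l.length + 1) / 2 := by
  induction a, l, acc using carrySave.induct with
  | case1 a acc => simp [carrySave]
  | case2 a b acc => simp [carrySave]
  | case3 a b c l acc ih => rw [carrySave, ih]; simp; omega

/-- The number in lane `i` given by binary digit slices. -/
def laneValue (i : ℕ) : List ℕ → ℕ
  | [] => 0
  | s :: ps => (s.testBit i).toNat + 2 * laneValue i ps

theorem laneValue_planes (i k : ℕ) (l : List ℕ) (h : l.length < 2 ^ k) :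
    laneValue i (planes k l) = laneSum i l := by
  induction k generalizing l with
  | zero =>
    have : l = [] := by simpa using h
    simp [this, planes, laneValue, laneSum]
  | succ k ih =>
    cases l with
    | nil => simp [planes, laneValue, laneSum]
    | cons a l =>
      have h2 : (carrySave a l []).2.length < 2 ^ k := by
        rw [length_carrySave]
        simp only [List.length_cons, pow_succ] at h
        simp
        omega
      have := laneSum_carrySave i a l []
      simp only [planes, laneValue, ih _ h2, this]
      simp [laneSum]

theorem testBit_eqMask (n i : ℕ) (ps : List ℕ) (j : ℕ) :
    (eqMask (ones n) ps j).testBit i = (decide (i < n) && decide (laneValue i ps = j)) := by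
  induction ps generalizing j with
  | nil =>
    cases j with
    | zero => simpa [eqMask, laneValue] using testBit_ones n i
    | succ j =>
      change (0 : ℕ).testBit i = _
      simp [laneValue]
  | cons s ps ih =>
    change ((bif Nat.beq (Nat.mod j 2) 1 then s else (s ^^^ ones n)) &&&
      eqMask (ones n) ps (j / 2)).testBit i = _
    rw [Nat.testBit_land, ih, beq_mod_two, Nat.testBit_zero]
    by_cases hi : i < n
    · rcases Nat.mod_two_eq_zero_or_one j with hj | hj <;>
      cases hs : s.testBit i <;>
      simp [hj, hi, hs, laneValue, testBit_ones] <;> omega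
    · simp [hi]

theorem popCount_eq (k x : ℕ) (h : x < 2 ^ 2 ^ k) :
    popCount k x = (List.range (2 ^ k)).countP x.testBit := by
  induction k generalizing x with
  | zero =>
    have : x < 2 := by simpa using h
    interval_cases x <;> rfl
  | succ k ih =>
    have hpow : 2 ^ (k + 1) = 2 ^ k + 2 ^ k := by ring
    have hlo : Nat.sub x (Nat.shiftLeft (Nat.shiftRight x (Nat.pow 2 k)) (Nat.pow 2 k)) =
        x % 2 ^ 2 ^ k := by
      change x - (x >>> 2 ^ k) <<< 2 ^ k = _
      rw [Nat.shiftRight_eq_div_pow, Nat.shiftLeft_eq, Nat.mod_eq_sub_div_mul]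
    have hhi : Nat.shiftRight x (Nat.pow 2 k) = x / 2 ^ 2 ^ k := Nat.shiftRight_eq_div_pow _ _
    rw [popCount, hlo, hhi, ih _ (Nat.mod_lt _ (by positivity)),
      ih _ (Nat.div_lt_of_lt_mul (by rwa [← pow_add, ← hpow])), hpow, List.range_add,
      List.countP_append, List.countP_map]
    have h1 : (List.range (2 ^ k)).countP (x % 2 ^ 2 ^ k).testBit =
        (List.range (2 ^ k)).countP x.testBit :=
      List.countP_congr fun i hi => by simp [Nat.testBit_mod_two_pow, List.mem_range.1 hi]
    have h2 : (List.range (2 ^ k)).countP (x / 2 ^ 2 ^ k).testBit =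
        (List.range (2 ^ k)).countP (x.testBit ∘ fun i => 2 ^ k + i) :=
      List.countP_congr fun i _ => by simp [Nat.testBit_div_two_pow, add_comm]
    rw [h1, h2]
    rcases Nat.eq_zero_or_pos x with rfl | hx
    · have h0 (l : List ℕ) (f : ℕ → ℕ) : l.countP (Nat.testBit 0 ∘ f) = 0 := by
        simp [List.countP_eq_zero]
      exact (congrArg₂ (· + ·) (h0 _ id) (h0 _ _)).symm
    · have : Nat.beq x 0 = false := by
        cases x with
        | zero => simp at hx
        | succ x => rfl
      rw [this]
      rfl

theorem popCount_eqMask (n : ℕ) (ps : List ℕ) (j : ℕ) :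
    popCount (Nat.add (Nat.log2 n) 1) (eqMask (ones n) ps j) =
      (List.range n).countP fun i => laneValue i ps = j := by
  have hn : n ≤ 2 ^ (n.log2 + 1) := Nat.lt_log2_self.le
  change popCount (n.log2 + 1) _ = _
  rw [popCount_eq]
  · obtain ⟨d, hd⟩ := Nat.exists_eq_add_of_le hn
    rw [hd, List.range_add, List.countP_append, List.countP_map]
    have h0 : (List.range d).countP ((eqMask (ones n) ps j).testBit ∘ fun i => n + i) = 0 := by
      simp [List.countP_eq_zero, testBit_eqMask]
    rw [h0, add_zero]
    exact List.countP_congr fun i hi => by simp [testBit_eqMask, List.mem_range.1 hi]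
  · refine lt_of_lt_of_le (Nat.lt_pow_two_of_testBit (n := n) _ fun i hi => ?_)
      (Nat.pow_le_pow_right two_pos hn)
    simp [testBit_eqMask, hi]

theorem Represents.blockCount_eq {p : ℕ × List ℕ} {rows : List ℕ} {k : ℕ}
    (h : Represents p rows k) (js : List ℕ) (c : ℕ) :
    blockCount js p c = js.map fun j => sumCount j rows k c := by
  unfold blockCount
  refine List.map_congr_left fun j _ => ?_
  rw [← h.laneCount_eq, popCount_eqMask, laneCount]
  refine List.countP_congr fun i hi => ?_
  rw [laneValue_planes _ _ _ (by rw [length_addConst, h.length_eq]; norm_num),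
    ← laneWeight_zero, laneWeight_addConst _ _ (List.mem_range.1 hi), Nat.zero_xor]

theorem sumCount_zero (j c : ℕ) (rows rows' : List ℕ) :
    sumCount j rows 0 c = sumCount j rows' 0 c := by
  cases rows <;> cases rows' <;> rfl

theorem branchCount_eq (js : List ℕ) {rows : List ℕ} (os : List ℕ) {k : ℕ}
    {t : List (ℕ × List ℕ)} (h : RepresentsAll rows k t) (c : ℕ) :
    branchCount js os t c = js.map fun j => sumCount j (os ++ rows) k c := by
  induction os generalizing k t c with
  | nil =>
    match k, t, h with
    | 0, [p], h => exact h.blockCount_eq js c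
    | k + 1, [p], h => cases k <;> exact h.2.elim
    | k + 1, p :: q :: t, h => exact h.1.blockCount_eq js c
  | cons o os ih =>
    match k, t, h with
    | 0, [p], h =>
      rw [show branchCount js (o :: os) [p] c = blockCount js p c from rfl,
        Represents.blockCount_eq h]
      exact List.map_congr_left fun j _ => sumCount_zero _ _ _ _
    | k + 1, [p], h => cases k <;> exact h.2.elim
    | k + 1, p :: q :: t, h =>
      rw [branchCount, ih h, ih h.2, List.zipWith_map, List.zipWith_self]
      rfl

/-- The numbers of sums of `k` rows among `outer ++ inner`, translated by `c`, of weights `js`. -/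
def count (js outer inner : List ℕ) (k c : ℕ) : List ℕ :=
  branchCount js outer (table k inner) c

theorem count_eq (js outer inner : List ℕ) (k c : ℕ) :
    count js outer inner k c = js.map fun j => sumCount j (outer ++ inner) k c :=
  branchCount_eq js outer (representsAll_table k inner) c

end BitSliced
namespace BitSliced

/-- The bit of a Boolean in the field with two elements. -/
def toF2 (b : Bool) : ZMod 2 := if b then 1 else 0

theorem toF2_xor (a b : Bool) : toF2 (a ^^ b) = toF2 a + toF2 b := by
  cases a <;> cases b <;> decide

theorem toF2_ne_zero (b : Bool) : toF2 b ≠ 0 ↔ b = true := by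
  cases b <;> simp [toF2]

/-- The matrix with `n` columns whose rows are given by the binary expansions of `rows`. -/
def toMatrix (rows : List ℕ) (m n : ℕ) : Matrix (Fin m) (Fin n) (ZMod 2) :=
  fun i k => toF2 ((rows.getD i 0).testBit k)

theorem laneWeight_replicate (n c : ℕ) :
    laneWeight (List.replicate n 0) 0 c = hammingNorm fun k : Fin n => toF2 (c.testBit k) := by
  induction n generalizing c with
  | zero => simp [laneWeight, hammingNorm]
  | succ n ih =>
    rw [List.replicate_succ, laneWeight, ih]
    simp only [hammingNorm, Finset.card_filter, Fin.sum_univ_succ, toF2_ne_zero]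
    simp only [Nat.testBit_div_two, Fin.val_zero, Fin.val_succ]
    congr 1
    rw [Nat.zero_testBit, Bool.false_xor]
    by_cases h : c.testBit 0 = true <;> simp [h]

/-- The sum of those rows that are selected by the binary digits of `c`. -/
def combine : List ℕ → ℕ → ℕ
  | [], _ => 0
  | r :: rs, c => (bif Nat.beq (c % 2) 1 then r else 0) ^^^ combine rs (c / 2)

theorem toF2_testBit_combine (rows : List ℕ) (m : ℕ) (hm : rows.length = m) (c k : ℕ) :
    toF2 ((combine rows c).testBit k) =
      ∑ l : Fin m, toF2 (c.testBit l) * toF2 ((rows.getD l 0).testBit k) := by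
  induction rows generalizing m c with
  | nil =>
    obtain rfl : m = 0 := hm.symm
    simp [combine, toF2]
  | cons r rs ih =>
    obtain ⟨m, rfl⟩ : ∃ n, m = n + 1 := ⟨rs.length, by simpa using hm.symm⟩
    rw [combine, Nat.testBit_xor, toF2_xor, ih m (by simpa using hm), Fin.sum_univ_succ,
      show Nat.beq (c % 2) 1 = c.testBit 0 from beq_mod_two c]
    congr 1
    · cases h : c.testBit 0 <;> simp [h, toF2]
    · simp [Nat.testBit_div_two]

theorem toMatrix_mul_toMatrix (rows rows' : List ℕ) {l m n : ℕ} (hm : rows'.length = m)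
    (i : Fin l) (k : Fin n) :
    (toMatrix rows l m * toMatrix rows' m n) i k =
      toF2 ((combine rows' (rows.getD i 0)).testBit k) := by
  rw [toF2_testBit_combine rows' m hm]
  rfl

theorem hammingNorm_cons {n : ℕ} (a : ZMod 2) (x : Fin n → ZMod 2) :
    hammingNorm (Fin.cons a x : Fin (n + 1) → ZMod 2) =
      (if a ≠ 0 then 1 else 0) + hammingNorm x := by
  simp only [hammingNorm, Finset.card_filter, Fin.sum_univ_succ, Fin.cons_zero, Fin.cons_succ]

theorem card_filter_cons {m : ℕ} (P : (Fin (m + 1) → ZMod 2) → Prop) [DecidablePred P] :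
    (Finset.univ.filter P).card =
      (Finset.univ.filter fun x : Fin m → ZMod 2 => P (Fin.cons 0 x)).card +
      (Finset.univ.filter fun x : Fin m → ZMod 2 => P (Fin.cons 1 x)).card := by
  simp only [Finset.card_filter]
  rw [← (Fin.consEquiv fun _ : Fin (m + 1) => ZMod 2).sum_comp, Fintype.sum_prod_type]
  exact Fin.sum_univ_two _

theorem sumCount_eq_card (j : ℕ) (rows : List ℕ) (m : ℕ) (hm : rows.length = m) (t c : ℕ) :
    sumCount j rows t c =
      (Finset.univ.filter fun x : Fin m → ZMod 2 => hammingNorm x = t ∧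
        hammingNorm (fun k : Fin 40 =>
          toF2 (c.testBit k) + (Matrix.vecMul x (toMatrix rows m 40)) k) = j).card := by
  induction rows generalizing m t c with
  | nil =>
    obtain rfl : m = 0 := hm.symm
    cases t with
    | zero =>
      rw [sumCount, weight, laneWeight_replicate]
      simp [Matrix.vecMul, Finset.card_filter, hammingNorm]
      split_ifs <;> simp
    | succ t => simp [sumCount, hammingNorm]
  | cons r rs ih =>
    obtain ⟨m, rfl⟩ : ∃ n, m = n + 1 := ⟨rs.length, by simpa using hm.symm⟩
    have hl : rs.length = m := by simpa using hm
    have key : ∀ (a : ZMod 2) (x : Fin m → ZMod 2) (k : Fin 40),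
        Matrix.vecMul (Fin.cons a x : Fin (m + 1) → ZMod 2) (toMatrix (r :: rs) (m + 1) 40) k =
          a * toF2 (r.testBit k) + Matrix.vecMul x (toMatrix rs m 40) k := by
      intro a x k
      simp [Matrix.vecMul, dotProduct, Fin.sum_univ_succ, toMatrix]
    rw [card_filter_cons]
    simp only [hammingNorm_cons, key]
    cases t with
    | zero =>
      rw [sumCount_zero j c _ rs, ih m hl]
      simp
    | succ t =>
      rw [sumCount, ih m hl, ih m hl]
      simp [toF2_xor, add_assoc, add_comm 1]

end BitSliced

section SystematicCode

open Matrix BitSliced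

variable {n : ℕ}

/-- The encoder `x ↦ (x, xA)` of the code with generator matrix `[I | A]`. -/
def systematicEncoder (A : Matrix (Fin n) (Fin n) (ZMod 2)) :
    (Fin n → ZMod 2) →ₗ[ZMod 2] (Fin (n + n) → ZMod 2) where
  toFun x := Fin.append x (x ᵥ* A)
  map_add' x y := by
    ext i
    refine Fin.addCases (fun i => ?_) (fun i => ?_) i <;>
      simp [Matrix.add_vecMul, -Fin.natAdd_eq_addNat]
  map_smul' a x := by
    ext i
    refine Fin.addCases (fun i => ?_) (fun i => ?_) i <;>
      simp [Matrix.smul_vecMul, -Fin.natAdd_eq_addNat]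

theorem systematicEncoder_injective (A : Matrix (Fin n) (Fin n) (ZMod 2)) :
    Function.Injective (systematicEncoder A) := by
  intro x y h
  ext i
  simpa [systematicEncoder] using congrFun h (Fin.castAdd n i)

theorem sum_append_mul (x y : Fin n → ZMod 2) (w : Fin (n + n) → ZMod 2) :
    ∑ i, Fin.append x y i * w i =
      x ⬝ᵥ (fun i => w (Fin.castAdd n i)) + y ⬝ᵥ (fun i => w (Fin.natAdd n i)) := by
  simp [Fin.sum_univ_add, dotProduct, -Fin.natAdd_eq_addNat]

theorem range_systematicEncoder_eq_dualCode (A : Matrix (Fin n) (Fin n) (ZMod 2))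
    (hA : A * Aᵀ = 1) :
    LinearMap.range (systematicEncoder A) = dualCode (LinearMap.range (systematicEncoder A)) := by
  have hA' : Aᵀ * A = 1 := mul_eq_one_comm.1 hA
  ext w
  constructor
  · rintro ⟨x, rfl⟩ _ ⟨y, rfl⟩
    change ∑ i, Fin.append y (y ᵥ* A) i * Fin.append x (x ᵥ* A) i = 0
    rw [sum_append_mul]
    simp only [Fin.append_left, Fin.append_right]
    rw [← Matrix.dotProduct_mulVec, ← Matrix.mulVec_transpose, Matrix.mulVec_mulVec, hA,
      Matrix.one_mulVec]
    exact CharTwo.add_self_eq_zero _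
  · intro hw
    set a : Fin n → ZMod 2 := fun i => w (Fin.castAdd n i) with ha
    set b : Fin n → ZMod 2 := fun i => w (Fin.natAdd n i) with hb
    have hab : a + A *ᵥ b = 0 := by
      refine dotProduct_eq_zero_iff.1 fun x => ?_
      have := hw _ ⟨x, rfl⟩
      change ∑ i, Fin.append x (x ᵥ* A) i * w i = 0 at this
      rw [sum_append_mul, ← Matrix.dotProduct_mulVec, ← dotProduct_add] at this
      rw [dotProduct_comm]
      exact this
    have hab' : a = A *ᵥ b := by
      have := congrArg (· + A *ᵥ b) hab
      simpa [add_assoc, ← two_smul (ZMod 2), show (2 : ZMod 2) = 0 from rfl] using this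
    have hb' : a ᵥ* A = b := by
      rw [hab', ← Matrix.mulVec_transpose, Matrix.mulVec_mulVec, hA', Matrix.one_mulVec]
    refine ⟨a, ?_⟩
    change Fin.append a (a ᵥ* A) = w
    rw [hb']
    ext i
    refine Fin.addCases (fun i => ?_) (fun i => ?_) i <;>
      simp [ha, hb, -Fin.natAdd_eq_addNat]

theorem hammingNorm_systematicEncoder (A : Matrix (Fin n) (Fin n) (ZMod 2)) (x : Fin n → ZMod 2) :
    hammingNorm (systematicEncoder A x) = hammingNorm x + hammingNorm (x ᵥ* A) := by
  simp only [hammingNorm, Finset.card_filter, Fin.sum_univ_add]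
  simp [systematicEncoder, -Fin.natAdd_eq_addNat]

/-- The number of `x` such that `x` has weight `t` and `xA` has weight `j`. -/
def splitCount (A : Matrix (Fin n) (Fin n) (ZMod 2)) (t j : ℕ) : ℕ :=
  (Finset.univ.filter fun x : Fin n → ZMod 2 => hammingNorm x = t ∧ hammingNorm (x ᵥ* A) = j).card

theorem splitCount_transpose (A : Matrix (Fin n) (Fin n) (ZMod 2)) (hA : A * Aᵀ = 1) (t j : ℕ) :
    splitCount Aᵀ j t = splitCount A t j := by
  have hA' : Aᵀ * A = 1 := mul_eq_one_comm.1 hA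
  refine Finset.card_nbij' (· ᵥ* Aᵀ) (· ᵥ* A) ?_ ?_ ?_ ?_ <;> intro x hx <;>
    simp_all [Matrix.vecMul_vecMul]

theorem ncard_range_systematicEncoder (A : Matrix (Fin n) (Fin n) (ZMod 2)) (w : ℕ) :
    {v | v ∈ LinearMap.range (systematicEncoder A) ∧ hammingNorm v = w}.ncard =
      ∑ t ∈ Finset.range (w + 1), splitCount A t (w - t) := by
  have h : {v | v ∈ LinearMap.range (systematicEncoder A) ∧ hammingNorm v = w} =
      systematicEncoder A '' (Finset.univ.filter fun x : Fin n → ZMod 2 =>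
        hammingNorm x + hammingNorm (x ᵥ* A) = w) := by
    ext v
    constructor
    · rintro ⟨⟨x, rfl⟩, hx⟩
      exact ⟨x, by simpa [hammingNorm_systematicEncoder] using hx, rfl⟩
    · rintro ⟨x, hx, rfl⟩
      exact ⟨⟨x, rfl⟩, by simpa [hammingNorm_systematicEncoder] using hx⟩
  rw [h, Set.ncard_image_of_injective _ (systematicEncoder_injective A), Set.ncard_coe_finset,
    Finset.card_eq_sum_card_fiberwise (f := hammingNorm) (t := Finset.range (w + 1))]
  · refine Finset.sum_congr rfl fun t ht => ?_
    rw [Finset.filter_filter, splitCount]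
    congr 1
    ext x
    simp only [Finset.mem_range] at ht
    simp only [Finset.mem_filter, Finset.mem_univ, true_and]
    omega
  · intro x hx
    simp at hx ⊢
    omega

theorem splitCount_ne_zero (A : Matrix (Fin n) (Fin n) (ZMod 2)) (x : Fin n → ZMod 2) :
    splitCount A (hammingNorm x) (hammingNorm (x ᵥ* A)) ≠ 0 :=
  Finset.card_ne_zero_of_mem (a := x) (by simp)

theorem splitCount_toMatrix (rows : List ℕ) (h : rows.length = 40) (t j : ℕ) :
    splitCount (toMatrix rows 40 40) t j = sumCount j rows t 0 := by
  rw [sumCount_eq_card j rows 40 h, splitCount]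
  simp [toF2]

end SystematicCode

section ExplicitCode

open Matrix BitSliced

/-- The rows of a matrix `A` such that the rows of `[I | A]` generate a self-dual
`[80, 40, 14]` code. -/
def codeRows : List ℕ :=
  [881710473448, 663909319121, 228308059042, 456615069509, 913230139018, 261389940779,
   354388818472, 208775254382, 960215190941, 636085195076, 814681311159, 345319621904,
   690639243808, 281766859841, 97319636412, 27553714439, 658357962545, 110213809181,
   716439252229, 440855236724, 197713241446, 395426482892, 790852965784, 987180617231,
   502908826463, 363089185278, 101823069373, 626208233018, 37092681226, 570565011755,
   786349980950, 296739352658, 593477656741, 87444734282, 812381136810, 349775791403,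
   699551582806, 299592586412, 129380764774, 98856620723]

/-- The columns of the matrix with rows `codeRows`. -/
def codeCols : List ℕ :=
  [589040166186, 957703292084, 486534989704, 198640288241, 621953109250, 1018680661221,
   354388812427, 708776576279, 61796110222, 636085146716, 465414090008, 345319428464,
   690638856928, 25586565217, 856219438626, 283565380260, 312378092456, 110214011921,
   220428023842, 149426550245, 989470253254, 292545448652, 585090897304, 361243897488,
   431764739008, 282683813057, 858138614818, 288477410981, 321680057258, 124894497812,
   249787947049, 207207953906, 742182298885, 898790900042, 991730386741, 296628716843,
   886095171574, 87004288172, 174007527769, 91952060179]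

/-- The matrix with rows `codeRows`. -/
def codeMatrix : Matrix (Fin 40) (Fin 40) (ZMod 2) := toMatrix codeRows 40 40

theorem toMatrix_codeCols : toMatrix codeCols 40 40 = codeMatrixᵀ := by
  have h : ∀ i k : Fin 40, (codeCols.getD i 0).testBit k = (codeRows.getD k 0).testBit i := by
    decide +kernel
  ext i k
  exact congrArg toF2 (h i k)

theorem codeMatrix_mul_transpose : codeMatrix * codeMatrixᵀ = 1 := by
  have h : ∀ i : Fin 40, combine codeCols (codeRows.getD i 0) = 2 ^ (i : ℕ) := by
    decide +kernel
  ext i k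
  rw [← toMatrix_codeCols, codeMatrix, toMatrix_mul_toMatrix codeRows codeCols (m := 40) rfl, h,
    Nat.testBit_two_pow, Matrix.one_apply, toF2]
  simp [Fin.ext_iff]

theorem sumCount_drop (j : ℕ) (rows : List ℕ) (i k c : ℕ) (h : i < rows.length) :
    sumCount j (rows.drop i) (k + 1) c = sumCount j (rows.drop (i + 1)) (k + 1) c +
      sumCount j (rows.drop (i + 1)) k (c ^^^ rows[i]) := by
  rw [List.drop_eq_getElem_cons h, sumCount]

theorem map_sumCount_eq {js rows l : List ℕ} {k c : ℕ} (m : ℕ)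
    (h : count js (rows.take m) (rows.drop m) k c = l) :
    js.map (fun j => sumCount j rows k c) = l := by
  rw [← h, count_eq, List.take_append_drop]

theorem sumCount_codeRows_drop_one :
    sumCount 8 (codeRows.drop 1) 7 codeRows[0] = 2085 := by
  have h : count [8] ((codeRows.drop 1).take 2) ((codeRows.drop 1).drop 2) 7 codeRows[0] =
      [2085] := by
    decide +kernel
  exact List.head_eq_of_cons_eq (map_sumCount_eq 2 h)

theorem sumCount_codeRows_drop_two :
    sumCount 8 (codeRows.drop 2) 7 codeRows[1] = 1749 := by
  have h : count [8] ((codeRows.drop 2).take 2) ((codeRows.drop 2).drop 2) 7 codeRows[1] =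
      [1749] := by
    decide +kernel
  exact List.head_eq_of_cons_eq (map_sumCount_eq 2 h)

theorem sumCount_codeRows_drop_three :
    sumCount 8 (codeRows.drop 3) 7 codeRows[2] = 1315 := by
  have h : count [8] ((codeRows.drop 3).take 2) ((codeRows.drop 3).drop 2) 7 codeRows[2] =
      [1315] := by
    decide +kernel
  exact List.head_eq_of_cons_eq (map_sumCount_eq 2 h)

theorem sumCount_codeRows_drop_four :
    sumCount 8 (codeRows.drop 4) 7 codeRows[3] = 1106 := by
  have h : count [8] ((codeRows.drop 4).take 2) ((codeRows.drop 4).drop 2) 7 codeRows[3] =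
      [1106] := by
    decide +kernel
  exact List.head_eq_of_cons_eq (map_sumCount_eq 2 h)

theorem sumCount_codeRows_drop_five :
    sumCount 8 (codeRows.drop 5) 7 codeRows[4] = 910 := by
  have h : count [8] ((codeRows.drop 5).take 2) ((codeRows.drop 5).drop 2) 7 codeRows[4] =
      [910] := by
    decide +kernel
  exact List.head_eq_of_cons_eq (map_sumCount_eq 2 h)

theorem sumCount_codeRows_drop_five_eight : sumCount 8 (codeRows.drop 5) 8 0 = 3112 := by
  have h : count [8] ((codeRows.drop 5).take 3) ((codeRows.drop 5).drop 3) 8 0 = [3112] := by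
    decide +kernel
  exact List.head_eq_of_cons_eq (map_sumCount_eq 3 h)

theorem sumCount_codeRows_eight : sumCount 8 codeRows 8 0 = 10277 := by
  have h : codeRows.length = 40 := rfl
  rw [← List.drop_zero (l := codeRows), sumCount_drop _ _ _ _ _ (by omega),
    sumCount_drop _ _ _ _ _ (by omega), sumCount_drop _ _ _ _ _ (by omega),
    sumCount_drop _ _ _ _ _ (by omega), sumCount_drop _ _ _ _ _ (by omega)]
  simp only [Nat.zero_xor, Nat.zero_add, Nat.reduceAdd, sumCount_codeRows_drop_one,
    sumCount_codeRows_drop_two, sumCount_codeRows_drop_three, sumCount_codeRows_drop_four,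
    sumCount_codeRows_drop_five, sumCount_codeRows_drop_five_eight]

/-- The number of sums of `t ≤ 6` members of `codeRows` of weight `j ≤ 16 - t`. -/
def codeRowsTable : List (List ℕ) :=
  [[1, 0, 0, 0, 0, 0, 0, 0, 0, 0, 0, 0, 0, 0, 0, 0, 0],
    [0, 0, 0, 0, 0, 0, 0, 0, 0, 0, 0, 0, 0, 0, 0, 24],
    [0, 0, 0, 0, 0, 0, 0, 0, 0, 0, 0, 0, 11, 0, 52],
    [0, 0, 0, 0, 0, 0, 0, 0, 0, 0, 0, 39, 0, 176],
    [0, 0, 0, 0, 0, 0, 0, 0, 0, 0, 134, 0, 858],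
    [0, 0, 0, 0, 0, 0, 0, 0, 0, 356, 0, 2838],
    [0, 0, 0, 0, 0, 0, 0, 0, 530, 0, 6074]]

theorem count_codeRows : ∀ t ≤ 6,
    count (List.range (17 - t)) (codeRows.take 3) (codeRows.drop 3) t 0 = codeRowsTable.getD t [] := by
  decide +kernel

theorem sumCount_codeRows {t j : ℕ} (ht : t ≤ 6) (hj : t + j ≤ 16) :
    sumCount j codeRows t 0 = (codeRowsTable.getD t []).getD j 0 := by
  rw [← map_sumCount_eq 3 (count_codeRows t ht), List.getD_eq_getElem?_getD, List.getElem?_map,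
    List.getElem?_range (by omega)]
  rfl

/-- The number of sums of `t ≤ 6` members of `codeCols` of weight `j ≤ 16 - t`. -/
def codeColsTable : List (List ℕ) :=
  [[1, 0, 0, 0, 0, 0, 0, 0, 0, 0, 0, 0, 0, 0, 0, 0, 0],
    [0, 0, 0, 0, 0, 0, 0, 0, 0, 0, 0, 0, 0, 2, 0, 16],
    [0, 0, 0, 0, 0, 0, 0, 0, 0, 0, 0, 0, 8, 0, 40],
    [0, 0, 0, 0, 0, 0, 0, 0, 0, 0, 0, 49, 0, 218],
    [0, 0, 0, 0, 0, 0, 0, 0, 0, 0, 127, 0, 802],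
    [0, 0, 0, 0, 0, 0, 0, 0, 0, 331, 0, 2690],
    [0, 0, 0, 0, 0, 0, 0, 0, 590, 0, 6270]]

theorem count_codeCols : ∀ t ≤ 6,
    count (List.range (17 - t)) (codeCols.take 3) (codeCols.drop 3) t 0 = codeColsTable.getD t [] := by
  decide +kernel

theorem sumCount_codeCols {t j : ℕ} (ht : t ≤ 6) (hj : t + j ≤ 16) :
    sumCount j codeCols t 0 = (codeColsTable.getD t []).getD j 0 := by
  rw [← map_sumCount_eq 3 (count_codeCols t ht), List.getD_eq_getElem?_getD, List.getElem?_map,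
    List.getElem?_range (by omega)]
  rfl

theorem count_codeRows_seven :
    count [7, 9] (codeRows.take 3) (codeRows.drop 3) 7 0 = [639, 9302] := by
  decide +kernel

theorem count_codeCols_seven :
    count [9] (codeCols.take 3) (codeCols.drop 3) 7 0 = [9032] := by
  decide +kernel

theorem splitCount_codeMatrix {t j : ℕ} (ht : t ≤ 6) (hj : t + j ≤ 16) :
    splitCount codeMatrix t j = (codeRowsTable.getD t []).getD j 0 := by
  rw [codeMatrix, splitCount_toMatrix codeRows rfl, sumCount_codeRows ht hj]

theorem splitCount_codeMatrix_right {t j : ℕ} (hj : j ≤ 6) (ht : t + j ≤ 16) :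
    splitCount codeMatrix t j = (codeColsTable.getD j []).getD t 0 := by
  rw [← splitCount_transpose codeMatrix codeMatrix_mul_transpose, ← toMatrix_codeCols,
    splitCount_toMatrix codeCols rfl, sumCount_codeCols hj (by omega)]

theorem splitCount_codeMatrix_seven_seven : splitCount codeMatrix 7 7 = 639 := by
  rw [codeMatrix, splitCount_toMatrix codeRows rfl]
  exact List.head_eq_of_cons_eq (map_sumCount_eq 3 count_codeRows_seven)

theorem splitCount_codeMatrix_seven_nine : splitCount codeMatrix 7 9 = 9302 := by
  rw [codeMatrix, splitCount_toMatrix codeRows rfl]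
  exact List.head_eq_of_cons_eq
    (List.tail_eq_of_cons_eq (map_sumCount_eq 3 count_codeRows_seven))

theorem splitCount_codeMatrix_nine_seven : splitCount codeMatrix 9 7 = 9032 := by
  rw [← splitCount_transpose codeMatrix codeMatrix_mul_transpose, ← toMatrix_codeCols,
    splitCount_toMatrix codeCols rfl]
  exact List.head_eq_of_cons_eq (map_sumCount_eq 3 count_codeCols_seven)

theorem splitCount_codeMatrix_eight_eight : splitCount codeMatrix 8 8 = 10277 := by
  rw [codeMatrix, splitCount_toMatrix codeRows rfl, sumCount_codeRows_eight]

theorem codeTables_eq_zero : ∀ t ≤ 6, ∀ j < 14, t + j < 14 → t + j ≠ 0 →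
    (codeRowsTable.getD t []).getD j 0 = 0 ∧ (codeColsTable.getD t []).getD j 0 = 0 := by
  decide +kernel

theorem splitCount_codeMatrix_eq_zero {t j : ℕ} (h : t + j < 14) (h0 : t + j ≠ 0) :
    splitCount codeMatrix t j = 0 := by
  rcases Nat.lt_or_ge t 7 with ht | ht
  · rw [splitCount_codeMatrix (by omega) (by omega)]
    exact (codeTables_eq_zero t (by omega) j (by omega) h h0).1
  · rw [splitCount_codeMatrix_right (by omega) (by omega)]
    exact (codeTables_eq_zero j (by omega) t (by omega) (by omega) (by omega)).2

theorem ncard_hammingNorm_eq_fourteen :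
    {v | v ∈ LinearMap.range (systematicEncoder codeMatrix) ∧ hammingNorm v = 14}.ncard =
      2816 := by
  rw [ncard_range_systematicEncoder]
  have h : ∀ t ∈ Finset.range 15, splitCount codeMatrix t (14 - t) =
      if t ≤ 6 then (codeRowsTable.getD t []).getD (14 - t) 0 else
      if t = 7 then 639 else (codeColsTable.getD (14 - t) []).getD t 0 := by
    intro t ht
    rw [Finset.mem_range] at ht
    split_ifs with h1 h2
    · exact splitCount_codeMatrix h1 (by omega)
    · rw [h2, splitCount_codeMatrix_seven_seven]
    · exact splitCount_codeMatrix_right (by omega) (by omega)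
  rw [Finset.sum_congr rfl h]
  decide +kernel

theorem ncard_hammingNorm_eq_sixteen :
    {v | v ∈ LinearMap.range (systematicEncoder codeMatrix) ∧ hammingNorm v = 16}.ncard =
      48669 := by
  rw [ncard_range_systematicEncoder]
  have h : ∀ t ∈ Finset.range 17, splitCount codeMatrix t (16 - t) =
      if t ≤ 6 then (codeRowsTable.getD t []).getD (16 - t) 0 else
      if t = 7 then 9302 else if t = 8 then 10277 else if t = 9 then 9032 else
      (codeColsTable.getD (16 - t) []).getD t 0 := by
    intro t ht
    rw [Finset.mem_range] at ht
    split_ifs with h1 h2 h3 h4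
    · exact splitCount_codeMatrix h1 (by omega)
    · rw [h2, splitCount_codeMatrix_seven_nine]
    · rw [h3, splitCount_codeMatrix_eight_eight]
    · rw [h4, splitCount_codeMatrix_nine_seven]
    · exact splitCount_codeMatrix_right (by omega) (by omega)
  rw [Finset.sum_congr rfl h]
  decide +kernel

end ExplicitCode

theorem stmt16 : ∃ C : Submodule (ZMod 2) (Fin 80 → ZMod 2),
    C = dualCode C ∧
    Module.finrank (ZMod 2) C = 40 ∧
    (∀ v ∈ C, v ≠ 0 → 14 ≤ hammingNorm v) ∧
    (∃ v ∈ C, hammingNorm v = 14) ∧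
    {v : Fin 80 → ZMod 2 | v ∈ C ∧ hammingNorm v = 14}.ncard = 2816 ∧
    {v : Fin 80 → ZMod 2 | v ∈ C ∧ hammingNorm v = 16}.ncard = 48669 := by
  refine ⟨LinearMap.range (systematicEncoder codeMatrix),
    range_systematicEncoder_eq_dualCode _ codeMatrix_mul_transpose, ?_, ?_, ?_,
    ncard_hammingNorm_eq_fourteen, ncard_hammingNorm_eq_sixteen⟩
  · rw [LinearMap.finrank_range_of_inj (systematicEncoder_injective codeMatrix)]
    simp
  · rintro _ ⟨x, rfl⟩ hx
    by_contra! hlt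
    rw [← hammingNorm_ne_zero_iff] at hx
    rw [hammingNorm_systematicEncoder] at hx hlt
    exact splitCount_ne_zero codeMatrix x (splitCount_codeMatrix_eq_zero hlt hx)
  · obtain ⟨v, hv⟩ := Set.nonempty_of_ncard_ne_zero
      (ne_of_eq_of_ne ncard_hammingNorm_eq_fourteen (by norm_num))
    exact ⟨v, hv⟩
end
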